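/- Let ν > 1, a ∈ F_{2^{m_1}}^*, b ∈ F_4^*, and let ω ∈ F_{2^n}^* have U_1-polar component w_1. Then 3·(W_{f_{a,b}}(ω) − 1) = −(2·2^{(2^{ν−1}−1)·m} − 1)·(1 − K_{m_1}(a)) − 2·2^{(2^{ν−1}−1)·m}·(2^{m−1} − 1)·(−1)^{f_a(w_1)} + 3·2^{m+1}·S_ν(a, b, ω). -/

import Mathlib

open Finset

attribute [local instance] Classical.propDecidable

noncomputable section

/-- The absolute trace `Tr^k` of `GF(2^k)`, as a function on an ambient field of
characteristic two containing `GF(2^k)`. -/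
def absTr {F : Type*} [Field F] (k : ℕ) (x : F) : F :=
  ∑ i ∈ Finset.range k, x ^ 2 ^ i

/-- The relative field trace `Tr^k_j` from `GF(2^k)` to `GF(2^j)`. -/
def relTr {F : Type*} [Field F] (k j : ℕ) (x : F) : F :=
  ∑ i ∈ Finset.range (k / j), x ^ 2 ^ (j * i)

/-- `(-1)^b` for `b ∈ F_2`, viewed inside an ambient field of characteristic two. -/
def sgn {F : Type*} [Field F] (b : F) : ℤ := if b = 0 then 1 else -1

/-- The subfield `GF(2^k)` of the ambient field, as a finset. -/
def gf (F : Type*) [Field F] [Fintype F] (k : ℕ) : Finset F :=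
  Finset.univ.filter fun x => x ^ 2 ^ k = x

/-- The trace of `F_4` down to `F_2`, `tr_2(y) = y + y²`. -/
def tr2 {F : Type*} [Field F] (y : F) : F := y + y ^ 2

/-- The cubic multiplicative character `χ_k(x) = x^((2^k-1)/3)` of `GF(2^k)`. -/
def chi {F : Type*} [Field F] (k : ℕ) (x : F) : F := x ^ ((2 ^ k - 1) / 3)

/-- The Walsh transform at `ω` of a Boolean function on `GF(2^n)`
(with values in `F_2` inside the ambient field). -/
def walsh {F : Type*} [Field F] [Fintype F] (n : ℕ) (f : F → F) (ω : F) : ℤ :=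
  ∑ x : F, sgn (f x + absTr n (ω * x))

/-- The binary Kloosterman sum `K_k(a)` (with the convention `0⁻¹ = 0`). -/
def kloo {F : Type*} [Field F] [Fintype F] (k : ℕ) (a : F) : ℤ :=
  ∑ x ∈ gf F k, sgn (absTr k (a * x + x⁻¹))

/-- The binary cubic sum `C_k(a,b)`. -/
def cub {F : Type*} [Field F] [Fintype F] (k : ℕ) (a b : F) : ℤ :=
  ∑ x ∈ gf F k, sgn (absTr k (a * x ^ 3 + b * x))

/-- `f_a(x) = Tr^n(a · x^(2^{m₁}-1))`. -/
def fA {F : Type*} [Field F] (n m1 : ℕ) (a x : F) : F :=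
  absTr n (a * x ^ (2 ^ m1 - 1))

/-- `g_b(x) = tr_2(b · χ_n(x))`. -/
def gB {F : Type*} [Field F] (n : ℕ) (b x : F) : F := tr2 (b * chi n x)

/-- The binomial Boolean function `f_{a,b} = f_a + g_b`. -/
def fAB {F : Type*} [Field F] (n m1 : ℕ) (a b x : F) : F :=
  fA n m1 a x + gB n b x

/-- `U`, the image of `U_1 × ⋯ × U_ν` in `GF(2^n)^*` under multiplication, where
`U_i` is the subgroup of `(2^{m_i}+1)`-th roots of unity and `m_i = 2^{ν-i}·m`. -/
def bigU (F : Type*) [Field F] [Fintype F] (ν m : ℕ) : Finset F :=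
  Finset.univ.filter fun u => ∃ c : Fin ν → F,
    (∀ i : Fin ν, c i ^ (2 ^ (2 ^ (ν - 1 - (i : ℕ)) * m) + 1) = 1) ∧ u = ∏ i, c i

/-- The sum `S_ν(a, b, ω) = ∑ (−1)^{f_a(u₁)}`, ranging over `u ∈ U` with polar
components `u₁ ∈ U_1, …, u_ν ∈ U_ν` such that `Tr^n_{m_{ν−1}}(u·ω) ≠ 0`,
`Tr^n_{m_ν}(u·ω) = 0` and `b·χ_n(u_ν) = 1`. -/
def Snu {F : Type*} [Field F] [Fintype F] (n m ν : ℕ) (hν : 0 < ν)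
    (a b ω : F) : ℤ :=
  ∑ c ∈ Finset.univ.filter (fun c : Fin ν → F =>
      (∀ i : Fin ν, c i ^ (2 ^ (2 ^ (ν - 1 - (i : ℕ)) * m) + 1) = 1) ∧
      relTr n (2 * m) ((∏ i, c i) * ω) ≠ 0 ∧
      relTr n m ((∏ i, c i) * ω) = 0 ∧
      b * chi n (c ⟨ν - 1, by omega⟩) = 1),
    sgn (fA n (2 ^ (ν - 1) * m) a (c ⟨0, hν⟩))

section Subfields

variable {F : Type*} [Field F]

lemma mem_gf [Fintype F] {k : ℕ} {x : F} : x ∈ gf F k ↔ x ^ 2 ^ k = x := by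
  simp [gf]

lemma pow_two_pow_mul {j : ℕ} {x : F} (hx : x ^ 2 ^ j = x) (i : ℕ) : x ^ 2 ^ (j * i) = x := by
  induction i with
  | zero => simp
  | succ i ih => rw [Nat.mul_succ, pow_add, pow_mul, ih, hx]

lemma gf_subset [Fintype F] {j k : ℕ} (h : j ∣ k) : gf F j ⊆ gf F k := by
  obtain ⟨i, rfl⟩ := h
  intro x hx
  rw [mem_gf] at *
  exact pow_two_pow_mul hx i

lemma mul_mem_gf [Fintype F] {k : ℕ} {x y : F} (hx : x ∈ gf F k) (hy : y ∈ gf F k) :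
    x * y ∈ gf F k := by
  rw [mem_gf] at *
  rw [mul_pow, hx, hy]

lemma inv_mem_gf [Fintype F] {k : ℕ} {x : F} (hx : x ∈ gf F k) : x⁻¹ ∈ gf F k := by
  rw [mem_gf] at *
  rw [inv_pow, hx]

lemma pow_mem_gf [Fintype F] {k : ℕ} {x : F} (hx : x ∈ gf F k) (i : ℕ) : x ^ i ∈ gf F k := by
  rw [mem_gf] at *
  rw [← pow_mul, mul_comm, pow_mul, hx]

lemma zero_mem_gf [Fintype F] (k : ℕ) : (0 : F) ∈ gf F k := by
  simp [mem_gf]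

lemma add_mem_gf [Fintype F] [CharP F 2] {k : ℕ} {x y : F} (hx : x ∈ gf F k)
    (hy : y ∈ gf F k) : x + y ∈ gf F k := by
  rw [mem_gf] at *
  rw [add_pow_char_pow, hx, hy]

lemma pow_two_pow_sub_one {k : ℕ} {x : F} (hx : x ^ 2 ^ k = x) (hx0 : x ≠ 0) :
    x ^ (2 ^ k - 1) = 1 := by
  apply mul_right_cancel₀ hx0
  rw [← pow_succ, Nat.sub_add_cancel Nat.one_le_two_pow, hx, one_mul]

lemma pow_two_pow_eq {k : ℕ} {x : F} (hx : x ^ (2 ^ k - 1) = 1) : x ^ 2 ^ k = x := by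
  rw [← Nat.sub_add_cancel (Nat.one_le_two_pow (n := k)), pow_succ, hx, one_mul]

lemma charP_two_of_card [Fintype F] {n : ℕ} (hF : Fintype.card F = 2 ^ n) : CharP F 2 := by
  obtain ⟨p, hp⟩ := CharP.exists F
  obtain ⟨i, hpp, hi⟩ := FiniteField.card F p
  have h : p ∣ 2 ^ n := by
    rw [← hF, hi]
    exact dvd_pow_self p i.ne_zero
  have h2 : p = 2 := (Nat.prime_dvd_prime_iff_eq hpp Nat.prime_two).1 (hpp.dvd_of_dvd_pow h)
  exact h2 ▸ hp

lemma gf_eq_univ [Fintype F] {n : ℕ} (hF : Fintype.card F = 2 ^ n) : gf F n = univ := by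
  ext x
  simpa [mem_gf, hF] using FiniteField.pow_card x

lemma card_gf [Fintype F] {n k : ℕ} (hF : Fintype.card F = 2 ^ n) (hk : k ∣ n) (hk0 : 0 < k) :
    #(gf F k) = 2 ^ k := by
  have hpos : 0 < 2 ^ k - 1 := Nat.sub_pos_of_lt (Nat.one_lt_two_pow hk0.ne')
  obtain ⟨g, hg⟩ := IsCyclic.exists_ofOrder_eq_natCard (α := Fˣ)
  have hcard : orderOf g = 2 ^ n - 1 := by
    rw [hg, Nat.card_eq_fintype_card, Fintype.card_units, hF]
  obtain ⟨d, hd⟩ := Nat.pow_sub_one_dvd_pow_sub_one 2 hk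
  have hn : 0 < n := by
    rcases Nat.eq_zero_or_pos n with rfl | h
    · have := Fintype.one_lt_card (α := F)
      simp [hF] at this
    · exact h
  have hprim : IsPrimitiveRoot ((g : F) ^ d) (2 ^ k - 1) := by
    have h1 : IsPrimitiveRoot (g : F) (2 ^ n - 1) := by
      rw [← hcard, ← orderOf_units]
      exact IsPrimitiveRoot.orderOf _
    exact h1.pow (Nat.sub_pos_of_lt (Nat.one_lt_two_pow hn.ne')) (by rw [hd, mul_comm])
  have h : gf F k = insert 0 (Polynomial.nthRootsFinset (2 ^ k - 1) (1 : F)) := by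
    ext x
    rw [mem_gf, mem_insert, Polynomial.mem_nthRootsFinset hpos]
    refine ⟨fun h => ?_, ?_⟩
    · by_cases hx : x = 0
      · exact Or.inl hx
      · exact Or.inr (pow_two_pow_sub_one h hx)
    · rintro (rfl | h)
      · simp
      · exact pow_two_pow_eq h
  have h0 : (0 : F) ∉ Polynomial.nthRootsFinset (2 ^ k - 1) (1 : F) := by
    rw [Polynomial.mem_nthRootsFinset hpos, zero_pow hpos.ne']
    exact zero_ne_one
  rw [h, card_insert_of_notMem h0, hprim.card_nthRootsFinset,
    Nat.sub_add_cancel Nat.one_le_two_pow]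

lemma card_gf_erase [Fintype F] {n k : ℕ} (hF : Fintype.card F = 2 ^ n) (hk : k ∣ n)
    (hk0 : 0 < k) : (#((gf F k).erase 0) : ℤ) = 2 ^ k - 1 := by
  rw [card_erase_of_mem (zero_mem_gf k), card_gf hF hk hk0, Nat.cast_sub Nat.one_le_two_pow]
  simp

/-- Scaling by a nonzero element of `GF(2^k)` permutes `GF(2^k)^*`. -/
lemma sum_gf_erase_mul [Fintype F] {k : ℕ} {c : F} (hc : c ∈ gf F k) (hc0 : c ≠ 0)
    (g : F → ℤ) : ∑ y ∈ (gf F k).erase 0, g (c * y) = ∑ y ∈ (gf F k).erase 0, g y := by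
  refine Finset.sum_nbij' (fun y => c * y) (fun y => c⁻¹ * y) ?_ ?_ ?_ ?_ ?_
  · intro y hy
    rw [mem_erase] at *
    exact ⟨mul_ne_zero hc0 hy.1, mul_mem_gf hc hy.2⟩
  · intro y hy
    rw [mem_erase] at *
    exact ⟨mul_ne_zero (inv_ne_zero hc0) hy.1, mul_mem_gf (inv_mem_gf hc) hy.2⟩
  · intro y _
    simp [hc0]
  · intro y _
    simp [hc0]
  · intro y _
    rfl

lemma sum_erase_mul [Fintype F] {c : F} (hc0 : c ≠ 0) (g : F → ℤ) :
    ∑ x ∈ univ.erase (0 : F), g (c * x) = ∑ x ∈ univ.erase (0 : F), g x := by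
  refine Finset.sum_nbij' (fun y => c * y) (fun y => c⁻¹ * y) ?_ ?_ ?_ ?_ ?_ <;>
    simp_all

/-- Averaging a sum over `F^*` over the cosets of `GF(2^k)^*`. -/
lemma sum_average [Fintype F] {n k : ℕ} (hF : Fintype.card F = 2 ^ n) (hk : k ∣ n)
    (hk0 : 0 < k) (g : F → ℤ) :
    (2 ^ k - 1) * ∑ x ∈ univ.erase (0 : F), g x =
      ∑ x ∈ univ.erase (0 : F), ∑ y ∈ (gf F k).erase 0, g (y * x) := by
  rw [sum_comm, ← card_gf_erase hF hk hk0, ← nsmul_eq_mul, ← sum_const]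
  refine sum_congr rfl fun y hy => ?_
  rw [sum_erase_mul (mem_erase.1 hy).1]

end Subfields

section Traces

variable {F : Type*} [Field F]

lemma absTr_eq_relTr (k : ℕ) (x : F) : absTr k x = relTr k 1 x := by
  simp [absTr, relTr]

lemma relTr_mul {k j : ℕ} {c : F} (hc : c ^ 2 ^ j = c) (x : F) :
    relTr k j (c * x) = c * relTr k j x := by
  simp only [relTr, mul_sum, mul_pow, pow_two_pow_mul hc]

lemma relTr_zero (k j : ℕ) : relTr k j (0 : F) = 0 := by
  simp [relTr]

lemma relTr_add [CharP F 2] (k j : ℕ) (x y : F) :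
    relTr k j (x + y) = relTr k j x + relTr k j y := by
  simp only [relTr, add_pow_char_pow, sum_add_distrib]

lemma absTr_add [CharP F 2] (k : ℕ) (x y : F) : absTr k (x + y) = absTr k x + absTr k y := by
  simp only [absTr_eq_relTr, relTr_add]

lemma relTr_pow_two_pow [CharP F 2] (k j i : ℕ) (x : F) :
    relTr k j x ^ 2 ^ i = relTr k j (x ^ 2 ^ i) := by
  simp only [relTr, sum_pow_char_pow, ← pow_mul, mul_comm]

lemma relTr_trans [CharP F 2] {j l k : ℕ} (hj0 : 0 < j) (hl0 : 0 < l) (hjl : j ∣ l)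
    (hlk : l ∣ k) (x : F) : relTr l j (relTr k l x) = relTr k j x := by
  obtain ⟨p, rfl⟩ := hjl
  obtain ⟨q, rfl⟩ := hlk
  have h1 : j * p * q / j = p * q := by rw [mul_assoc, Nat.mul_div_cancel_left _ hj0]
  simp only [relTr, h1, Nat.mul_div_cancel_left _ hj0, Nat.mul_div_cancel_left _ hl0,
    sum_pow_char_pow]
  clear h1
  induction q with
  | zero => simp
  | succ q ih =>
    rw [Nat.mul_succ, sum_range_add, ← ih, ← sum_add_distrib]
    refine sum_congr rfl fun i _ => ?_
    rw [sum_range_succ, ← pow_mul, ← pow_add]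
    congr 3
    ring

lemma relTr_pow_self {k j : ℕ} (hjk : j ∣ k) {x : F} (hx : x ^ 2 ^ k = x) :
    relTr k j (x ^ 2 ^ j) = relTr k j x := by
  obtain ⟨q, rfl⟩ := hjk
  rcases Nat.eq_zero_or_pos j with rfl | hj
  · simp [relTr]
  simp only [relTr, Nat.mul_div_cancel_left _ hj]
  have h := sum_range_succ' (fun i => x ^ 2 ^ (j * i)) q
  rw [sum_range_succ, hx] at h
  simp only [mul_zero, pow_zero, pow_one] at h
  rw [add_right_cancel h]
  refine sum_congr rfl fun i _ => ?_
  rw [← pow_mul, ← pow_add, Nat.mul_succ, add_comm j]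

lemma relTr_mem_gf [Fintype F] [CharP F 2] {k j : ℕ} (hjk : j ∣ k) {x : F} (hx : x ∈ gf F k) :
    relTr k j x ∈ gf F j := by
  rw [mem_gf] at *
  rw [relTr_pow_two_pow, relTr_pow_self hjk hx]

lemma absTr_relTr [CharP F 2] {k j : ℕ} (hj : 0 < j) (hjk : j ∣ k) (x : F) :
    absTr j (relTr k j x) = absTr k x := by
  rw [absTr_eq_relTr, absTr_eq_relTr, relTr_trans one_pos hj (one_dvd j) hjk]

lemma absTr_sq [Fintype F] [CharP F 2] {k : ℕ} {x : F} (hx : x ∈ gf F k) :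
    absTr k x ^ 2 = absTr k x := by
  simpa [mem_gf, absTr_eq_relTr] using relTr_mem_gf (one_dvd k) hx

lemma absTr_pow_two [Fintype F] {k : ℕ} {x : F} (hx : x ∈ gf F k) :
    absTr k (x ^ 2) = absTr k x := by
  simpa [absTr_eq_relTr] using relTr_pow_self (one_dvd k) (mem_gf.1 hx)

lemma sgn_zero : sgn (0 : F) = 1 := by simp [sgn]

lemma sgn_add [CharP F 2] {x y : F} (hx : x ^ 2 = x) (hy : y ^ 2 = y) :
    sgn (x + y) = sgn x * sgn y := by
  have key : ∀ z : F, z ^ 2 = z → z = 0 ∨ z = 1 := fun z hz => by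
    have : z * (z - 1) = 0 := by linear_combination hz
    rcases mul_eq_zero.1 this with h | h
    · exact Or.inl h
    · exact Or.inr (sub_eq_zero.1 h)
  rcases key x hx with rfl | rfl <;> rcases key y hy with rfl | rfl <;>
    simp [sgn, CharTwo.add_self_eq_zero]

lemma exists_absTr_ne_zero [Fintype F] {n k : ℕ} (hF : Fintype.card F = 2 ^ n) (hk : k ∣ n)
    (hk0 : 0 < k) : ∃ y ∈ gf F k, absTr k y ≠ 0 := by
  by_contra! h
  obtain ⟨k, rfl⟩ : ∃ l, k = l + 1 := ⟨k - 1, by omega⟩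
  let P : Polynomial F := ∑ i ∈ range (k + 1), Polynomial.X ^ 2 ^ i
  have hdeg : P.natDegree ≤ 2 ^ k := by
    refine Polynomial.natDegree_sum_le_of_forall_le _ _ fun i hi => ?_
    rw [Polynomial.natDegree_X_pow]
    exact Nat.pow_le_pow_right two_pos (by simpa [Nat.lt_succ_iff] using hi)
  have hP : P ≠ 0 := by
    intro h0
    have := congrArg (fun p => Polynomial.coeff p (2 ^ k)) h0
    simp [P, Polynomial.coeff_X_pow] at this
  have hsub : gf F (k + 1) ⊆ P.roots.toFinset := fun y hy => by
    rw [Multiset.mem_toFinset, Polynomial.mem_roots hP, Polynomial.IsRoot.def]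
    simpa [P, Polynomial.eval_finsetSum, absTr] using h y hy
  have := (card_le_card hsub).trans
    ((Multiset.toFinset_card_le _).trans ((Polynomial.card_roots' P).trans hdeg))
  rw [card_gf hF hk hk0] at this
  exact absurd this (not_le.2 (Nat.pow_lt_pow_right one_lt_two (Nat.lt_succ_self k)))

/-- Orthogonality of the additive characters of `GF(2^k)`. -/
lemma sum_sgn_absTr_mul [Fintype F] [CharP F 2] {n k : ℕ} (hF : Fintype.card F = 2 ^ n)
    (hk : k ∣ n) (hk0 : 0 < k) {t : F} (ht : t ∈ gf F k) :
    ∑ y ∈ gf F k, sgn (absTr k (y * t)) = if t = 0 then 2 ^ k else 0 := by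
  split_ifs with h0
  · simp [h0, absTr_eq_relTr, relTr_zero, sgn_zero, card_gf hF hk hk0]
  obtain ⟨z, hz, hz0⟩ := exists_absTr_ne_zero hF hk hk0
  have hzt : z * t⁻¹ ∈ gf F k := mul_mem_gf hz (inv_mem_gf ht)
  have h1 : ∑ y ∈ gf F k, sgn (absTr k (y * t)) =
      ∑ y ∈ gf F k, sgn (absTr k ((y + z * t⁻¹) * t)) := by
    refine Finset.sum_nbij' (fun y => y + z * t⁻¹) (fun y => y + z * t⁻¹)
      (fun y hy => add_mem_gf hy hzt) (fun y hy => add_mem_gf hy hzt) ?_ ?_ ?_ <;>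
    · intro y _
      simp only [add_assoc, CharTwo.add_self_eq_zero, add_zero]
  have h2 : ∑ y ∈ gf F k, sgn (absTr k ((y + z * t⁻¹) * t)) =
      -∑ y ∈ gf F k, sgn (absTr k (y * t)) := by
    rw [← sum_neg_distrib]
    refine sum_congr rfl fun y hy => ?_
    rw [add_mul, inv_mul_cancel_right₀ h0, absTr_add,
      sgn_add (absTr_sq (mul_mem_gf hy ht)) (absTr_sq hz)]
    simp [sgn, hz0]
  linarith

lemma sum_erase_sgn_absTr_mul [Fintype F] [CharP F 2] {n k : ℕ} (hF : Fintype.card F = 2 ^ n)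
    (hk : k ∣ n) (hk0 : 0 < k) {t : F} (ht : t ∈ gf F k) :
    ∑ y ∈ (gf F k).erase 0, sgn (absTr k (y * t)) = (if t = 0 then 2 ^ k else 0) - 1 := by
  rw [← sum_sgn_absTr_mul hF hk hk0 ht, ← add_sum_erase _ _ (zero_mem_gf k)]
  simp [absTr_eq_relTr, relTr_zero, sgn_zero]

/-- For `t ≠ 0` the kernel of `y ↦ Tr^k_j(yt)` on `GF(2^k)` has `2^(k-j)` elements. -/
lemma sum_relTr_eq_zero [Fintype F] [CharP F 2] {n k j : ℕ} (hF : Fintype.card F = 2 ^ n)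
    (hk : k ∣ n) (hk0 : 0 < k) (hj : j ∣ k) {t : F} (ht : t ∈ gf F k) (ht0 : t ≠ 0) :
    ∑ y ∈ (gf F k).erase 0, (if relTr k j (y * t) = 0 then (1 : ℤ) else 0) =
      2 ^ (k - j) - 1 := by
  have hj0 : 0 < j := Nat.pos_of_dvd_of_pos hj hk0
  have hjk : j ≤ k := Nat.le_of_dvd hk0 hj
  have h1 : (2 : ℤ) ^ j * ∑ y ∈ gf F k, (if relTr k j (y * t) = 0 then (1 : ℤ) else 0) =
      2 ^ k := by
    calc (2 : ℤ) ^ j * ∑ y ∈ gf F k, (if relTr k j (y * t) = 0 then (1 : ℤ) else 0)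
        = ∑ y ∈ gf F k, ∑ z ∈ gf F j, sgn (absTr j (z * relTr k j (y * t))) := by
          rw [mul_sum]
          refine sum_congr rfl fun y hy => ?_
          rw [sum_sgn_absTr_mul hF (hj.trans hk) hj0 (relTr_mem_gf hj (mul_mem_gf hy ht))]
          simp
      _ = ∑ z ∈ gf F j, ∑ y ∈ gf F k, sgn (absTr k (y * (z * t))) := by
          rw [sum_comm]
          refine sum_congr rfl fun z hz => sum_congr rfl fun y _ => ?_
          rw [← relTr_mul (mem_gf.1 hz), absTr_relTr hj0 hj, mul_left_comm]
      _ = ∑ z ∈ gf F j, if z = 0 then (2 : ℤ) ^ k else 0 := by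
          refine sum_congr rfl fun z hz => ?_
          rw [sum_sgn_absTr_mul hF hk hk0 (mul_mem_gf (gf_subset hj hz) ht)]
          simp [ht0]
      _ = 2 ^ k := by
          rw [sum_ite_eq' (gf F j) 0, if_pos (zero_mem_gf j)]
  rw [← Nat.add_sub_cancel' hjk, pow_add] at h1
  have h2 := mul_left_cancel₀ (pow_ne_zero j (two_ne_zero (α := ℤ))) h1
  rw [Nat.add_sub_cancel' hjk, ← add_sum_erase _ _ (zero_mem_gf k)] at h2
  simp only [zero_mul, relTr_zero, if_true] at h2
  linarith

end Traces

section PolarDecomposition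

variable {F : Type*} [Field F] [Fintype F]

omit [Fintype F] in
lemma sq_eq_sq_iff_charTwo [CharP F 2] {x y : F} : x ^ 2 = y ^ 2 ↔ x = y := by
  rw [← sub_eq_zero, ← sub_pow_char, pow_eq_zero_iff two_ne_zero, sub_eq_zero]

/-- Squaring permutes every set that it preserves in both directions. -/
lemma sum_comp_sq [CharP F 2] {s : Finset F} (hs : ∀ x, x ^ 2 ∈ s ↔ x ∈ s) (g : F → ℤ) :
    ∑ x ∈ s, g (x ^ 2) = ∑ x ∈ s, g x := by
  refine sum_equiv (frobeniusEquiv F 2).toEquiv (fun x => ?_) fun x _ => ?_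
  · simpa [frobenius_def] using (hs x).symm
  · simp [frobenius_def]

lemma sq_mem_gf_erase [CharP F 2] {k : ℕ} (x : F) :
    x ^ 2 ∈ (gf F k).erase 0 ↔ x ∈ (gf F k).erase 0 := by
  rw [mem_erase, mem_erase, mem_gf, mem_gf, ← pow_mul, mul_comm, pow_mul,
    sq_eq_sq_iff_charTwo, ne_eq, pow_eq_zero_iff two_ne_zero]

/-- The group of `N`-th roots of unity of `F`. -/
def unityRoots (F : Type*) [Field F] [Fintype F] (N : ℕ) : Finset F :=
  univ.filter fun u => u ^ N = 1

lemma mem_unityRoots {N : ℕ} {u : F} : u ∈ unityRoots F N ↔ u ^ N = 1 := by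
  simp [unityRoots]

lemma ne_zero_of_mem_unityRoots {N : ℕ} {u : F} (hu : u ∈ unityRoots F (N + 1)) : u ≠ 0 := by
  rintro rfl
  simp [mem_unityRoots] at hu

lemma sq_mem_unityRoots [CharP F 2] {N : ℕ} (x : F) :
    x ^ 2 ∈ unityRoots F N ↔ x ∈ unityRoots F N := by
  rw [mem_unityRoots, mem_unityRoots, ← pow_mul, mul_comm, pow_mul]
  nth_rewrite 1 [← one_pow 2]
  rw [sq_eq_sq_iff_charTwo]

lemma pow_eq_inv_of_mem_unityRoots {N : ℕ} {u : F} (hu : u ∈ unityRoots F (N + 1)) :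
    u ^ N = u⁻¹ := by
  rw [mem_unityRoots, pow_succ] at hu
  exact eq_inv_of_mul_eq_one_left hu

lemma pow_two_pow_two_mul {k : ℕ} {u : F} (hu : u ∈ unityRoots F (2 ^ k + 1)) :
    u ^ 2 ^ (2 * k) = u := by
  rw [two_mul, pow_add, pow_mul, pow_eq_inv_of_mem_unityRoots hu, inv_pow,
    pow_eq_inv_of_mem_unityRoots hu, inv_inv]

/-- The polar decomposition `GF(2^{2k})^* = U × GF(2^k)^*`. -/
lemma sum_polar_pair [CharP F 2] {k : ℕ} (hk : 0 < k) (Φ : F → ℤ) :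
    ∑ u ∈ unityRoots F (2 ^ k + 1), ∑ y ∈ (gf F k).erase 0, Φ (u * y) =
      ∑ x ∈ (gf F (2 * k)).erase 0, Φ x := by
  rw [← sum_product']
  have hsq : ∀ x : F, x ^ 2 ^ (2 * k) = x →
      ((x ^ (2 ^ k + 1)) ^ 2 ^ (k - 1)) ^ 2 = x ^ (2 ^ k + 1) := by
    intro x hx
    have hx' : (x ^ 2 ^ k) ^ 2 ^ k = x := by rw [← pow_mul, ← pow_add, ← two_mul, hx]
    rw [← pow_mul (x ^ (2 ^ k + 1)), ← pow_succ, Nat.sub_add_cancel hk, pow_succ, mul_pow, hx',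
      mul_comm]
  refine sum_bij (fun p _ => p.1 * p.2) ?_ ?_ ?_ ?_
  · rintro ⟨u, y⟩ h
    rw [mem_product, mem_erase] at h
    rw [mem_erase]
    exact ⟨mul_ne_zero (ne_zero_of_mem_unityRoots h.1) h.2.1,
      mul_mem_gf (mem_gf.2 (pow_two_pow_two_mul h.1)) (gf_subset (dvd_mul_left k 2) h.2.2)⟩
  · rintro ⟨u, y⟩ h ⟨u', y'⟩ h' heq
    rw [mem_product, mem_erase, mem_gf, mem_unityRoots] at h h'
    dsimp only at h h' heq
    have hy : y ^ 2 = y' ^ 2 := by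
      have := congrArg (fun z => z ^ (2 ^ k + 1)) heq
      simp only [mul_pow, h.1, h'.1, one_mul] at this
      rwa [pow_succ, pow_succ, h.2.2, h'.2.2, ← sq, ← sq] at this
    rw [sq_eq_sq_iff_charTwo] at hy
    subst hy
    rw [mul_right_cancel₀ h.2.1 heq]
  · intro x hx
    rw [mem_erase, mem_gf] at hx
    have h2 := hsq x hx.2
    set y := (x ^ (2 ^ k + 1)) ^ 2 ^ (k - 1) with hy
    have hy0 : y ≠ 0 := pow_ne_zero _ (pow_ne_zero _ hx.1)
    have hyk : y ^ 2 ^ k = y := by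
      rw [← sq_eq_sq_iff_charTwo, ← pow_mul, mul_comm, pow_mul, h2, pow_succ, mul_pow,
        ← pow_mul x, ← pow_add 2, ← two_mul, hx.2, mul_comm]
    refine ⟨(x * y⁻¹, y), ?_, by simp [hy0]⟩
    rw [mem_product, mem_erase, mem_gf, mem_unityRoots]
    refine ⟨?_, hy0, hyk⟩
    dsimp only
    rw [mul_pow, ← h2, inv_pow, pow_succ y (2 ^ k), hyk, ← sq]
    exact mul_inv_cancel₀ (pow_ne_zero _ hy0)
  · intros
    rfl

/-- The iterated polar decomposition `GF(2^{2^ν m})^* = U_1 × ⋯ × U_ν × GF(2^m)^*`. -/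
lemma sum_polar_tuple [CharP F 2] {m : ℕ} (hm : 0 < m) (ν : ℕ) (Φ : F → ℤ) :
    ∑ c ∈ univ.filter (fun c : Fin ν → F =>
        ∀ i : Fin ν, c i ^ (2 ^ (2 ^ (ν - 1 - (i : ℕ)) * m) + 1) = 1),
      ∑ y ∈ (gf F m).erase 0, Φ ((∏ i, c i) * y) =
      ∑ x ∈ (gf F (2 ^ ν * m)).erase 0, Φ x := by
  induction ν generalizing Φ with
  | zero =>
    rw [filter_true_of_mem fun c _ i => i.elim0]
    simp
  | succ ν ih =>
    rw [pow_succ', mul_assoc, ← sum_polar_pair (by positivity)]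
    simp_rw [← ih]
    refine Eq.trans ?_ (sum_product' _ _ _)
    refine sum_nbij' (fun c => (c 0, Fin.tail c)) (fun p => Fin.cons p.1 p.2) ?_ ?_ ?_ ?_ ?_
    · intro c hc
      simp only [mem_filter, mem_univ, true_and, mem_product, mem_unityRoots] at hc ⊢
      refine ⟨by simpa using hc 0, fun i => ?_⟩
      have h := hc i.succ
      have hi : ν + 1 - 1 - ((i.succ : Fin (ν + 1)) : ℕ) = ν - 1 - (i : ℕ) := by
        simp only [Fin.val_succ]
        omega
      rwa [hi] at h
    · rintro ⟨u, d⟩ h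
      simp only [mem_filter, mem_univ, true_and, mem_product, mem_unityRoots] at h ⊢
      intro i
      refine Fin.cases (by simpa using h.1) (fun i => ?_) i
      have hi : ν + 1 - 1 - ((i.succ : Fin (ν + 1)) : ℕ) = ν - 1 - (i : ℕ) := by
        simp only [Fin.val_succ]
        omega
      rw [hi, Fin.cons_succ]
      exact h.2 i
    · intro c _
      simp
    · rintro ⟨u, d⟩ _
      simp
    · intro c _
      simp only [Fin.prod_univ_succ, Fin.tail, mul_assoc]

lemma card_unityRoots [CharP F 2] {n k : ℕ} (hF : Fintype.card F = 2 ^ n) (hk : 2 * k ∣ n)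
    (hk0 : 0 < k) : (#(unityRoots F (2 ^ k + 1)) : ℤ) = 2 ^ k + 1 := by
  have h := sum_polar_pair (F := F) hk0 fun _ => 1
  simp only [sum_const, nsmul_eq_mul, mul_one] at h
  rw [card_gf_erase hF hk (by positivity),
    card_gf_erase hF ((dvd_mul_left k 2).trans hk) hk0] at h
  have h0 : (2 : ℤ) ^ k - 1 ≠ 0 := by
    have : (1 : ℤ) < 2 ^ k := one_lt_pow₀ one_lt_two hk0.ne'
    omega
  apply mul_right_cancel₀ h0
  rw [h]
  ring

end PolarDecomposition

section Kloosterman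

variable {F : Type*} [Field F] [Fintype F]

lemma add_inv_mem_gf [CharP F 2] {k : ℕ} {u : F} (hu : u ∈ unityRoots F (2 ^ k + 1)) :
    u + u⁻¹ ∈ gf F k := by
  rw [mem_gf, add_pow_char_pow, inv_pow, pow_eq_inv_of_mem_unityRoots hu, inv_inv, add_comm]

lemma eq_one_of_mem_unityRoots_of_mem_gf [CharP F 2] {k : ℕ} {u : F}
    (hu : u ∈ unityRoots F (2 ^ k + 1)) (hk : u ∈ gf F k) : u = 1 := by
  rw [mem_gf] at hk
  rw [mem_unityRoots, pow_succ, hk, ← sq] at hu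
  rwa [← sq_eq_sq_iff_charTwo, one_pow]

omit [Fintype F] in
lemma eq_or_eq_inv_of_add_inv_eq {x u : F} (hx : x ≠ 0) (hu : u ≠ 0)
    (h : x + x⁻¹ = u + u⁻¹) : x = u ∨ x = u⁻¹ := by
  have h1 : (x - u) * (x * u - 1) = 0 := by
    have h2 : (x - u) * (x * u - 1) = x * u * ((x + x⁻¹) - (u + u⁻¹)) := by
      field_simp
      ring
    rw [h2, h, sub_self, mul_zero]
  rcases mul_eq_zero.1 h1 with h | h
  · exact Or.inl (sub_eq_zero.1 h)
  · exact Or.inr (eq_inv_of_mul_eq_one_left (sub_eq_zero.1 h))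

lemma card_add_inv_fiber_le [CharP F 2] {k : ℕ} (t : F) :
    #((unityRoots F (2 ^ k + 1)).filter fun u => u + u⁻¹ = t) +
      #(((gf F k).erase 0).filter fun u => u + u⁻¹ = t) ≤ 2 := by
  set A := (unityRoots F (2 ^ k + 1)).filter fun u => u + u⁻¹ = t with hA
  set B := ((gf F k).erase 0).filter fun u => u + u⁻¹ = t with hB
  have hA0 : ∀ x ∈ A, x ≠ 0 ∧ x + x⁻¹ = t := fun x hx => by
    rw [hA, mem_filter] at hx
    exact ⟨ne_zero_of_mem_unityRoots hx.1, hx.2⟩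
  have hB0 : ∀ x ∈ B, x ≠ 0 ∧ x + x⁻¹ = t := fun x hx => by
    rw [hB, mem_filter, mem_erase] at hx
    exact ⟨hx.1.1, hx.2⟩
  by_cases ht : t = 0
  · have h1 : ∀ x : F, x ≠ 0 ∧ x + x⁻¹ = t → x ∈ ({1} : Finset F) := by
      rintro x ⟨hx, h⟩
      rw [mem_singleton]
      have h2 : x + x⁻¹ = 1 + (1 : F)⁻¹ := by
        rw [h, ht, inv_one, CharTwo.add_self_eq_zero]
      simpa using eq_or_eq_inv_of_add_inv_eq hx one_ne_zero h2
    have h2 := card_le_card (s := A) (t := {1}) fun x hx => h1 x (hA0 x hx)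
    have h3 := card_le_card (s := B) (t := {1}) fun x hx => h1 x (hB0 x hx)
    rw [card_singleton] at h2 h3
    omega
  · have hdisj : Disjoint A B := by
      rw [disjoint_left]
      intro x hx hx'
      rw [hA, mem_filter] at hx
      rw [hB, mem_filter, mem_erase] at hx'
      have h1 := eq_one_of_mem_unityRoots_of_mem_gf hx.1 hx'.1.2
      rw [h1, inv_one, CharTwo.add_self_eq_zero] at hx
      exact ht hx.2.symm
    rw [← card_union_of_disjoint hdisj]
    rcases (A ∪ B).eq_empty_or_nonempty with h | ⟨u, hu⟩
    · simp [h]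
    have hAB : ∀ x ∈ A ∪ B, x ≠ 0 ∧ x + x⁻¹ = t := fun x hx =>
      (mem_union.1 hx).elim (hA0 x) (hB0 x)
    refine (card_le_card (t := {u, u⁻¹}) fun x hx => ?_).trans card_le_two
    rw [mem_insert, mem_singleton]
    exact eq_or_eq_inv_of_add_inv_eq (hAB x hx).1 (hAB u hu).1
      ((hAB x hx).2.trans (hAB u hu).2.symm)

lemma mapsTo_add_inv_gf_erase [CharP F 2] {k : ℕ} {x : F} (hx : x ∈ (gf F k).erase 0) :
    x + x⁻¹ ∈ gf F k :=
  add_mem_gf (mem_erase.1 hx).2 (inv_mem_gf (mem_erase.1 hx).2)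

/-- Every element of `GF(2^k)` has exactly two representations `u + u⁻¹` with
`u` in `U ⊔ GF(2^k)^*`. -/
lemma card_add_inv_fiber [CharP F 2] {n k : ℕ} (hF : Fintype.card F = 2 ^ n) (hk : 2 * k ∣ n)
    (hk0 : 0 < k) {t : F} (ht : t ∈ gf F k) :
    #((unityRoots F (2 ^ k + 1)).filter fun u => u + u⁻¹ = t) +
      #(((gf F k).erase 0).filter fun u => u + u⁻¹ = t) = 2 := by
  have hkn : k ∣ n := (dvd_mul_left k 2).trans hk
  refine (sum_eq_sum_iff_of_le (s := gf F k) fun t _ => card_add_inv_fiber_le (k := k) t).1 ?_ t ht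
  have h1 := card_eq_sum_card_fiberwise (f := fun u : F => u + u⁻¹)
    (s := unityRoots F (2 ^ k + 1)) (t := gf F k) fun u hu => add_inv_mem_gf hu
  have h2 := card_eq_sum_card_fiberwise (f := fun u : F => u + u⁻¹)
    (s := (gf F k).erase 0) (t := gf F k) fun u hu => mapsTo_add_inv_gf_erase hu
  rw [sum_add_distrib, ← h1, ← h2, sum_const, card_gf hF hkn hk0]
  zify
  rw [card_unityRoots hF hk hk0, card_gf_erase hF hkn hk0, smul_eq_mul]
  push_cast
  ring

lemma sum_add_inv [CharP F 2] {n k : ℕ} (hF : Fintype.card F = 2 ^ n) (hk : 2 * k ∣ n)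
    (hk0 : 0 < k) (g : F → ℤ) :
    ∑ u ∈ unityRoots F (2 ^ k + 1), g (u + u⁻¹) + ∑ u ∈ (gf F k).erase 0, g (u + u⁻¹) =
      2 * ∑ t ∈ gf F k, g t := by
  have key : ∀ s : Finset F, (∀ u ∈ s, u + u⁻¹ ∈ gf F k) → ∑ u ∈ s, g (u + u⁻¹) =
      ∑ t ∈ gf F k, (#(s.filter fun u => u + u⁻¹ = t) : ℤ) * g t := fun s hs => by
    rw [← sum_fiberwise_of_maps_to hs]
    refine sum_congr rfl fun t _ => ?_
    rw [sum_congr rfl fun u hu => by rw [(mem_filter.1 hu).2], sum_const, nsmul_eq_mul]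
  rw [key _ fun u hu => add_inv_mem_gf hu, key _ fun u hu => mapsTo_add_inv_gf_erase hu,
    ← sum_add_distrib, mul_sum]
  refine sum_congr rfl fun t ht => ?_
  rw [← add_mul, ← Nat.cast_add, card_add_inv_fiber hF hk hk0 ht]
  rfl

lemma kloo_eq [CharP F 2] {k : ℕ} (hk0 : 0 < k) {a : F} (ha : a ∈ gf F k) (ha0 : a ≠ 0) :
    kloo k a = 1 + ∑ y ∈ (gf F k).erase 0, sgn (absTr k (a * (y + y⁻¹))) := by
  rw [kloo, ← add_sum_erase _ _ (zero_mem_gf k)]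
  congr 1
  · simp [absTr_eq_relTr, relTr_zero, sgn_zero]
  set c := a ^ 2 ^ (k - 1) with hc
  have hca : c ^ 2 = a := by
    rw [hc, ← pow_mul, ← pow_succ, Nat.sub_add_cancel hk0, mem_gf.1 ha]
  have hc0 : c ≠ 0 := pow_ne_zero _ ha0
  have hck : c ∈ gf F k := pow_mem_gf ha _
  rw [← sum_gf_erase_mul (inv_mem_gf hck) (inv_ne_zero hc0),
    ← sum_comp_sq sq_mem_gf_erase fun y => sgn (absTr k (a * (y + y⁻¹)))]
  refine sum_congr rfl fun y hy => ?_
  rw [← hca, ← absTr_pow_two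
    (add_mem_gf (mul_mem_gf (pow_mem_gf hck 2) (mul_mem_gf (inv_mem_gf hck) (mem_erase.1 hy).2))
      (inv_mem_gf (mul_mem_gf (inv_mem_gf hck) (mem_erase.1 hy).2)))]
  congr 2
  rw [← inv_pow y, add_pow_char, mul_inv, inv_inv]
  field_simp

lemma sum_unityRoots_eq [CharP F 2] {n k : ℕ} (hF : Fintype.card F = 2 ^ n) (hk : 2 * k ∣ n)
    (hk0 : 0 < k) {a : F} (ha : a ∈ gf F k) (ha0 : a ≠ 0) :
    ∑ u ∈ unityRoots F (2 ^ k + 1), sgn (absTr k (a * (u + u⁻¹))) = 1 - kloo k a := by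
  have h1 := sum_add_inv hF hk hk0 fun t => sgn (absTr k (a * t))
  have h2 := sum_sgn_absTr_mul hF ((dvd_mul_left k 2).trans hk) hk0 ha
  simp only [mul_comm _ a, if_neg ha0] at h2
  rw [h2] at h1
  rw [kloo_eq hk0 ha ha0]
  linarith

end Kloosterman

section CubicCharacter

variable {F : Type*} [Field F]

lemma three_dvd_two_pow_sub_one {k : ℕ} (hk : Even k) : 3 ∣ 2 ^ k - 1 := by
  obtain ⟨j, rfl⟩ := even_iff_two_dvd.1 hk
  exact Nat.pow_sub_one_dvd_pow_sub_one 2 (Dvd.intro j rfl)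

lemma three_dvd_two_pow_add_one {m : ℕ} (hm : Odd m) : 3 ∣ 2 ^ m + 1 := by
  simpa using Odd.nat_add_dvd_pow_add_pow 2 1 hm

lemma two_pow_mul_self_sub_one (k : ℕ) : (2 ^ k + 1) * (2 ^ k - 1) = 2 ^ (2 * k) - 1 := by
  rw [two_mul, pow_add, ← sq, ← Nat.sq_sub_sq, one_pow, sq]

lemma chi_mul (n : ℕ) (x y : F) : chi n (x * y) = chi n x * chi n y := mul_pow _ _ _

lemma chi_pow_three [Fintype F] {n : ℕ} (hF : Fintype.card F = 2 ^ n) (hn : Even n) {x : F}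
    (hx : x ≠ 0) : chi n x ^ 3 = 1 := by
  rw [chi, ← pow_mul, Nat.div_mul_cancel (three_dvd_two_pow_sub_one hn), ← hF]
  exact FiniteField.pow_card_sub_one_eq_one x hx

lemma chi_eq_one {n d : ℕ} (hd : d * 3 ∣ 2 ^ n - 1) {x : F} (hx : x ^ d = 1) :
    chi n x = 1 := by
  obtain ⟨e, he⟩ := hd
  rw [chi, he, mul_right_comm, Nat.mul_div_cancel _ three_pos, pow_mul, hx, one_pow]

lemma exists_chi_ne_one [Fintype F] {n : ℕ} (hF : Fintype.card F = 2 ^ n) (hn : Even n) :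
    ∃ x : F, x ≠ 0 ∧ chi n x ≠ 1 := by
  obtain ⟨g, hg⟩ := IsCyclic.exists_ofOrder_eq_natCard (α := Fˣ)
  have hcard : orderOf (g : F) = 2 ^ n - 1 := by
    rw [orderOf_units, hg, Nat.card_eq_fintype_card, Fintype.card_units, hF]
  have hpos : 0 < 2 ^ n - 1 := by
    rw [← hcard, orderOf_units]
    exact orderOf_pos g
  refine ⟨g, g.ne_zero, fun h => ?_⟩
  rw [chi, ← orderOf_dvd_iff_pow_eq_one, hcard] at h
  have h3 := Nat.le_of_dvd hpos (three_dvd_two_pow_sub_one hn)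
  have := Nat.le_of_dvd (Nat.div_pos h3 three_pos) h
  omega

/-- The cubic character is nontrivial on `GF(2^j)` when `[GF(2^n) : GF(2^j)]` is a power of
two and `j` is even. -/
lemma exists_mem_gf_chi_ne_one [Fintype F] {n j q : ℕ} (hF : Fintype.card F = 2 ^ n)
    (hj : Even j) (hn : n = j * 2 ^ q) : ∃ g ∈ gf F j, g ≠ 0 ∧ chi n g ≠ 1 := by
  have hne : Even n := hn ▸ hj.mul_right _
  obtain ⟨x, hx, hchi⟩ := exists_chi_ne_one hF hne
  set d := ∑ i ∈ range (2 ^ q), (2 ^ j) ^ i with hd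
  have hd1 : d * (2 ^ j - 1) = 2 ^ n - 1 := by
    have h := geom_sum_mul_add (2 ^ j - 1) (2 ^ q)
    rw [Nat.sub_add_cancel Nat.one_le_two_pow, ← pow_mul, ← hn] at h
    exact Nat.eq_sub_of_add_eq h
  have hd3 : Nat.Coprime 3 d := by
    have hmod : d ≡ 2 ^ q [MOD 3] := by
      have h1 : 2 ^ j ≡ 1 [MOD 3] :=
        ((Nat.modEq_iff_dvd' Nat.one_le_two_pow).2 (three_dvd_two_pow_sub_one hj)).symm
      have h2 : d ≡ ∑ i ∈ range (2 ^ q), 1 [MOD 3] := by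
        rw [hd]
        refine Nat.ModEq.sum fun i _ => ?_
        simpa using h1.pow i
      simpa using h2
    rw [Nat.Coprime, Nat.gcd_comm, hmod.gcd_eq]
    exact Nat.Coprime.pow_left q (by norm_num)
  refine ⟨x ^ d, mem_gf.2 (pow_two_pow_eq ?_), pow_ne_zero _ hx, fun h => hchi ?_⟩
  · rw [← pow_mul, hd1, ← hF]
    exact FiniteField.pow_card_sub_one_eq_one x hx
  · have h1 : chi n x ^ d = 1 := by
      rw [← h, chi, chi, ← pow_mul, ← pow_mul, mul_comm]
    have h2 := pow_gcd_eq_one.2 ⟨chi_pow_three hF hne hx, h1⟩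
    rwa [hd3.gcd_eq_one, pow_one] at h2

/-- The sign `(-1)^{tr_2(bχ_n(x))}` for `x ≠ 0`. -/
def cubicSign (n : ℕ) (b x : F) : ℤ := 2 * (if b * chi n x = 1 then 1 else 0) - 1

lemma sgn_tr2 [CharP F 2] {z : F} (hz : z ^ 3 = 1) :
    sgn (tr2 z) = 2 * (if z = 1 then 1 else 0) - 1 := by
  by_cases h : z = 1
  · simp [h, tr2, sgn, CharTwo.add_self_eq_zero]
  · have h1 : tr2 z ≠ 0 := by
      intro h0
      have h2 : z * (1 + z) = 0 := by rw [← h0, tr2]; ring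
      rcases mul_eq_zero.1 h2 with h3 | h3
      · simp [h3] at hz
      · exact h (CharTwo.add_eq_zero.1 h3).symm
    simp [sgn, h, h1]

lemma tr2_sq [CharP F 2] {z : F} (hz : z ^ 3 = 1) : tr2 z ^ 2 = tr2 z := by
  rw [tr2, add_pow_char]
  linear_combination z * hz

lemma sum_cube_root_indicator {z ζ : F} (hz : z ^ 3 = 1) (hζ : ζ ^ 3 = 1) (hζ1 : ζ ≠ 1) :
    (if z = 1 then (1 : ℤ) else 0) + (if ζ * z = 1 then 1 else 0) +
      (if ζ * (ζ * z) = 1 then 1 else 0) = 1 := by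
  have hζ2 : ζ * ζ ≠ 1 := fun h => hζ1 (by linear_combination hζ - ζ * h)
  have h1 : ζ ^ 2 + ζ + 1 = 0 := by
    have : (ζ - 1) * (ζ ^ 2 + ζ + 1) = 0 := by linear_combination hζ
    exact (mul_eq_zero.1 this).resolve_left (sub_ne_zero.2 hζ1)
  have h2 : (z - 1) * ((z - ζ) * (z - ζ ^ 2)) = 0 := by
    linear_combination hz - hζ + (-z ^ 2 + z) * h1 + z * hζ
  rcases mul_eq_zero.1 h2 with h | h
  · obtain rfl := sub_eq_zero.1 h
    simp [hζ1, hζ2]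
  rcases mul_eq_zero.1 h with h | h
  · obtain rfl := sub_eq_zero.1 h
    have h3 : z * (z * z) = 1 := by rw [← hz]; ring
    simp [hζ1, hζ2, h3]
  · obtain rfl := sub_eq_zero.1 h
    have h3 : ζ * ζ ^ 2 = 1 := by rw [← hζ]; ring
    have h4 : ζ ^ 2 ≠ 1 := by rwa [sq]
    simp [hζ1, h3, h4]

/-- The cubic sign sums to `-1/3` of the total against every weight invariant under an element
on which the cubic character is nontrivial. -/
lemma sum_mul_cubicSign [Fintype F] {n : ℕ} (hF : Fintype.card F = 2 ^ n) (hn : Even n)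
    {b g : F} (hb : b ^ 3 = 1) (hg : g ≠ 0) (hchi : chi n g ≠ 1) (w : F → ℤ)
    (hw : ∀ x, w (g * x) = w x) :
    3 * ∑ x ∈ univ.erase (0 : F), w x * cubicSign n b x = -∑ x ∈ univ.erase (0 : F), w x := by
  set I : F → ℤ := fun x => if b * chi n x = 1 then 1 else 0 with hI
  have h1 : ∑ x ∈ univ.erase (0 : F), w x * I (g * x) = ∑ x ∈ univ.erase (0 : F), w x * I x := by
    rw [← sum_erase_mul hg fun x => w x * I x]
    simp only [hw]
  have h2 : ∑ x ∈ univ.erase (0 : F), w x * I (g * (g * x)) =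
      ∑ x ∈ univ.erase (0 : F), w x * I (g * x) := by
    rw [← sum_erase_mul hg fun x => w x * I (g * x)]
    simp only [hw]
  have h3 : ∑ x ∈ univ.erase (0 : F), w x = ∑ x ∈ univ.erase (0 : F), w x * I x +
      ∑ x ∈ univ.erase (0 : F), w x * I (g * x) +
      ∑ x ∈ univ.erase (0 : F), w x * I (g * (g * x)) := by
    rw [← sum_add_distrib, ← sum_add_distrib]
    refine sum_congr rfl fun x hx => ?_
    have hz : (b * chi n x) ^ 3 = 1 := by
      rw [mul_pow, hb, chi_pow_three hF hn (mem_erase.1 hx).1, one_mul]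
    have key := sum_cube_root_indicator hz (chi_pow_three hF hn hg) hchi
    rw [← mul_add, ← mul_add]
    simp only [hI, chi_mul, mul_left_comm b]
    rw [key, mul_one]
  have h4 : ∑ x ∈ univ.erase (0 : F), w x * cubicSign n b x =
      2 * ∑ x ∈ univ.erase (0 : F), w x * I x - ∑ x ∈ univ.erase (0 : F), w x := by
    rw [mul_sum, ← sum_sub_distrib]
    refine sum_congr rfl fun x _ => ?_
    rw [cubicSign]
    ring
  rw [h4]
  linarith

end CubicCharacter

section NihoPart

variable {F : Type*} [Field F] [Fintype F]

omit [Fintype F] in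
lemma fA_mul_of_mem (n k : ℕ) (a : F) {y : F} (hy : y ^ 2 ^ k = y) (hy0 : y ≠ 0) (x : F) :
    fA n k a (y * x) = fA n k a x := by
  rw [fA, fA, mul_pow, pow_two_pow_sub_one hy hy0, one_mul]

omit [Fintype F] in
lemma relTr_two_mul {k : ℕ} (hk : 0 < k) (x : F) : relTr (2 * k) k x = x + x ^ 2 ^ k := by
  simp [relTr, Nat.mul_div_cancel _ hk, sum_range_succ]

lemma fA_eq [CharP F 2] {k : ℕ} (hF : Fintype.card F = 2 ^ (2 * k)) (hk : 0 < k) {a x : F}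
    (ha : a ∈ gf F k) (hx : x ≠ 0) :
    fA (2 * k) k a x = absTr k (a * (x ^ (2 ^ k - 1) + (x ^ (2 ^ k - 1))⁻¹)) := by
  have hz : x ^ (2 ^ k - 1) ∈ unityRoots F (2 ^ k + 1) := by
    rw [mem_unityRoots, ← pow_mul, mul_comm, two_pow_mul_self_sub_one, ← hF]
    exact FiniteField.pow_card_sub_one_eq_one x hx
  rw [fA, ← absTr_relTr hk (dvd_mul_left k 2), relTr_two_mul hk, mul_pow, mem_gf.1 ha,
    pow_eq_inv_of_mem_unityRoots hz, ← mul_add]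

lemma fA_inv [CharP F 2] {k : ℕ} (hF : Fintype.card F = 2 ^ (2 * k)) (hk : 0 < k) {a x : F}
    (ha : a ∈ gf F k) (hx : x ≠ 0) : fA (2 * k) k a x⁻¹ = fA (2 * k) k a x := by
  rw [fA_eq hF hk ha hx, fA_eq hF hk ha (inv_ne_zero hx), inv_pow, inv_inv, add_comm]

/-- The sum of `(-1)^{f_a}` over `F^*` in terms of a Kloosterman sum. -/
lemma sum_sgn_fA [CharP F 2] {k : ℕ} (hF : Fintype.card F = 2 ^ (2 * k)) (hk : 0 < k) {a : F}
    (ha : a ∈ gf F k) (ha0 : a ≠ 0) :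
    ∑ x ∈ univ.erase (0 : F), sgn (fA (2 * k) k a x) = (2 ^ k - 1) * (1 - kloo k a) := by
  rw [← gf_eq_univ hF, ← sum_polar_pair hk, ← sum_unityRoots_eq hF dvd_rfl hk ha ha0,
    ← sum_comp_sq sq_mem_unityRoots fun u => sgn (absTr k (a * (u + u⁻¹))), mul_sum]
  refine sum_congr rfl fun u hu => ?_
  rw [← card_gf_erase hF (dvd_mul_left k 2) hk, ← nsmul_eq_mul, ← sum_const]
  refine sum_congr rfl fun y hy => ?_
  rw [mem_erase, mem_gf] at hy
  have hu0 := ne_zero_of_mem_unityRoots hu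
  have hu2 : u ^ (2 ^ k - 1) = (u ^ 2)⁻¹ := by
    apply mul_right_cancel₀ hu0
    rw [← pow_succ, Nat.sub_add_cancel Nat.one_le_two_pow, pow_eq_inv_of_mem_unityRoots hu]
    field_simp
  rw [mul_comm u, fA_mul_of_mem _ _ _ hy.2 hy.1, fA_eq hF hk ha hu0, hu2, inv_inv, add_comm]

/-- The sum of `(-1)^{f_a(x)}` over the nonzero `x` with `Tr^n_{m_1}(xω) = 0`. -/
lemma sum_sgn_fA_relTr_half [CharP F 2] {k : ℕ} (hF : Fintype.card F = 2 ^ (2 * k))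
    (hk : 0 < k) {a w v : F} (ha : a ∈ gf F k) (hw0 : w ≠ 0) (hv : v ∈ gf F k) (hv0 : v ≠ 0) :
    ∑ x ∈ univ.erase (0 : F),
        (if relTr (2 * k) k (x * (w * v)) = 0 then sgn (fA (2 * k) k a x) else 0) =
      (2 ^ k - 1) * sgn (fA (2 * k) k a w) := by
  have hwv : w * v ≠ 0 := mul_ne_zero hw0 hv0
  rw [← sum_erase_mul (inv_ne_zero hwv), ← sum_filter, ← card_gf_erase hF (dvd_mul_left k 2) hk,
    ← nsmul_eq_mul, ← sum_const]
  refine sum_congr ?_ fun x hx => ?_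
  · ext x
    rw [mem_filter, mem_erase, mem_erase, mem_gf, mul_right_comm, inv_mul_cancel₀ hwv, one_mul,
      relTr_two_mul hk, CharTwo.add_eq_zero, eq_comm (a := x)]
    simp
  · rw [mem_erase] at hx
    rw [mul_inv, mul_assoc, mul_comm w⁻¹, fA_mul_of_mem _ _ _
      (mem_gf.1 (mul_mem_gf (inv_mem_gf hv) hx.2)) (mul_ne_zero (inv_ne_zero hv0) hx.1),
      fA_inv hF hk ha hw0]

lemma sum_sgn_fA_relTr [CharP F 2] {k j : ℕ} (hF : Fintype.card F = 2 ^ (2 * k))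
    (hk : 0 < k) (hj : j ∣ k) {a w v : F} (ha : a ∈ gf F k) (ha0 : a ≠ 0) (hw0 : w ≠ 0)
    (hv : v ∈ gf F k) (hv0 : v ≠ 0) :
    ∑ x ∈ univ.erase (0 : F),
        (if relTr (2 * k) j (x * (w * v)) = 0 then sgn (fA (2 * k) k a x) else 0) =
      (2 ^ (k - j) - 1) * (1 - kloo k a) +
        (2 ^ k - 2 ^ (k - j)) * sgn (fA (2 * k) k a w) := by
  have hj0 : 0 < j := Nat.pos_of_dvd_of_pos hj hk
  have hk2 : k ∣ 2 * k := dvd_mul_left k 2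
  have h0 : (2 : ℤ) ^ k - 1 ≠ 0 := by
    have : (1 : ℤ) < 2 ^ k := one_lt_pow₀ one_lt_two hk.ne'
    omega
  apply mul_left_cancel₀ h0
  rw [sum_average hF hk2 hk]
  have h1 : ∀ x : F, ∑ y ∈ (gf F k).erase 0,
      (if relTr (2 * k) j (y * x * (w * v)) = 0 then sgn (fA (2 * k) k a (y * x)) else 0) =
      (2 ^ (k - j) - 1) * sgn (fA (2 * k) k a x) + (2 ^ k - 2 ^ (k - j)) *
        (if relTr (2 * k) k (x * (w * v)) = 0 then sgn (fA (2 * k) k a x) else 0) := by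
    intro x
    set t := relTr (2 * k) k (x * (w * v)) with ht
    have htk : t ∈ gf F k := relTr_mem_gf hk2 (by rw [gf_eq_univ hF]; exact mem_univ _)
    have h2 : ∀ y ∈ (gf F k).erase 0,
        (if relTr (2 * k) j (y * x * (w * v)) = 0 then sgn (fA (2 * k) k a (y * x)) else 0) =
        (if relTr k j (y * t) = 0 then 1 else 0) * sgn (fA (2 * k) k a x) := by
      intro y hy
      rw [mem_erase, mem_gf] at hy
      rw [fA_mul_of_mem _ _ _ hy.2 hy.1, mul_assoc, ← relTr_trans hj0 hk hj hk2,
        relTr_mul hy.2, ← ht, ite_mul, one_mul, zero_mul]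
    rw [sum_congr rfl h2, ← sum_mul]
    by_cases h : t = 0
    · simp only [h, mul_zero, relTr_zero, if_true, sum_const, nsmul_eq_mul, mul_one,
        card_gf_erase hF hk2 hk]
      ring
    · rw [sum_relTr_eq_zero hF hk2 hk hj htk h, if_neg h]
      ring
  simp only [h1]
  rw [sum_add_distrib, ← mul_sum, ← mul_sum, sum_sgn_fA hF hk ha ha0,
    sum_sgn_fA_relTr_half hF hk ha hw0 hv hv0]
  ring

end NihoPart

section WalshTransform

variable {F : Type*} [Field F] [Fintype F]

omit [Fintype F] in
lemma relTr_mul_mul {k j : ℕ} {y : F} (hy : y ^ 2 ^ j = y) (x ω : F) :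
    relTr k j (y * x * ω) = y * relTr k j (x * ω) := by
  rw [mul_assoc, relTr_mul hy]

lemma chi_eq_one_of_mem_gf {n m : ℕ} (hm : Odd m) (hmn : 2 * m ∣ n) {y : F} (hy : y ∈ gf F m)
    (hy0 : y ≠ 0) : chi n y = 1 := by
  refine chi_eq_one ?_ (pow_two_pow_sub_one (mem_gf.1 hy) hy0)
  refine dvd_trans ?_ (Nat.pow_sub_one_dvd_pow_sub_one 2 hmn)
  rw [← two_pow_mul_self_sub_one, mul_comm]
  exact Nat.mul_dvd_mul_right (three_dvd_two_pow_add_one hm) _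

lemma chi_eq_one_of_mem_unityRoots {n k : ℕ} (hk : Even k) (hkn : 2 * k ∣ n) {u : F}
    (hu : u ∈ unityRoots F (2 ^ k + 1)) : chi n u = 1 := by
  refine chi_eq_one ?_ (mem_unityRoots.1 hu)
  refine dvd_trans ?_ (Nat.pow_sub_one_dvd_pow_sub_one 2 hkn)
  rw [← two_pow_mul_self_sub_one]
  exact Nat.mul_dvd_mul_left _ (three_dvd_two_pow_sub_one hk)

lemma sgn_fAB_add [CharP F 2] {n k : ℕ} (hF : Fintype.card F = 2 ^ n) (hn : Even n) {b x : F}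
    (hb : b ^ 3 = 1) (hx : x ≠ 0) (a z : F) :
    sgn (fAB n k a b x + absTr n z) =
      sgn (fA n k a x) * cubicSign n b x * sgn (absTr n z) := by
  have huniv : ∀ y : F, absTr n y ^ 2 = absTr n y := fun y =>
    absTr_sq (by rw [gf_eq_univ hF]; exact mem_univ y)
  have hz : (b * chi n x) ^ 3 = 1 := by
    rw [mul_pow, hb, chi_pow_three hF hn hx, one_mul]
  have h1 : fA n k a x ^ 2 = fA n k a x := huniv _
  have h2 : gB n b x ^ 2 = gB n b x := tr2_sq hz
  have h3 : fAB n k a b x ^ 2 = fAB n k a b x := by rw [fAB, add_pow_char, h1, h2]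
  rw [sgn_add h3 (huniv z), fAB, sgn_add h1 h2, gB, sgn_tr2 hz, cubicSign]

omit [Fintype F] in
lemma fAB_zero {n k : ℕ} (hn : 1 < n) (hk : 0 < k) (a b : F) : fAB n k a b 0 = 0 := by
  have h1 : 2 ^ k - 1 ≠ 0 := (Nat.sub_pos_of_lt (Nat.one_lt_two_pow hk.ne')).ne'
  have h2 : (2 ^ n - 1) / 3 ≠ 0 := by
    have : 2 ^ 2 ≤ 2 ^ n := Nat.pow_le_pow_right two_pos hn
    omega
  simp [fAB, fA, gB, chi, tr2, zero_pow h1, zero_pow h2, absTr_eq_relTr, relTr_zero]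

/-- The Walsh transform of `f_{a,b}` as a sum over the `x` with `Tr^n_m(xω) = 0`. -/
lemma walsh_sub_one [CharP F 2] {n k m : ℕ} (hF : Fintype.card F = 2 ^ n) (hm : Odd m)
    (hmn : 2 * m ∣ n) (hmk : m ∣ k) (hk : 0 < k) {b : F} (hb : b ^ 3 = 1) (a ω : F) :
    (2 ^ m - 1) * (walsh n (fAB n k a b) ω - 1) =
      2 ^ m * ∑ x ∈ univ.erase (0 : F), (if relTr n m (x * ω) = 0 then
          sgn (fA n k a x) else 0) * cubicSign n b x -
        ∑ x ∈ univ.erase (0 : F), sgn (fA n k a x) * cubicSign n b x := by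
  have hm' : m ∣ n := (dvd_mul_left m 2).trans hmn
  have hn2 : Even n := even_iff_two_dvd.2 ((dvd_mul_right 2 m).trans hmn)
  have hn0 : n ≠ 0 := by
    rintro rfl
    have := Fintype.one_lt_card (α := F)
    simp [hF] at this
  have hn1 : 1 < n := by
    obtain ⟨r, rfl⟩ := hn2
    omega
  have h1 : walsh n (fAB n k a b) ω - 1 = ∑ x ∈ univ.erase (0 : F),
      sgn (fA n k a x) * cubicSign n b x * sgn (absTr n (ω * x)) := by
    rw [walsh, ← add_sum_erase _ _ (mem_univ (0 : F)), fAB_zero hn1 hk, mul_zero,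
      absTr_eq_relTr, relTr_zero, add_zero, sgn_zero, add_sub_cancel_left]
    exact sum_congr rfl fun x hx => sgn_fAB_add hF hn2 hb (mem_erase.1 hx).1 _ _
  rw [h1, sum_average hF hm' hm.pos, mul_sum, ← sum_sub_distrib]
  refine sum_congr rfl fun x _ => ?_
  have h2 : ∀ y ∈ (gf F m).erase 0, sgn (fA n k a (y * x)) * cubicSign n b (y * x) *
      sgn (absTr n (ω * (y * x))) = sgn (fA n k a x) * cubicSign n b x *
        sgn (absTr m (y * relTr n m (x * ω))) := by
    intro y hy
    rw [mem_erase] at hy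
    rw [fA_mul_of_mem _ _ _ (mem_gf.1 (gf_subset hmk hy.2)) hy.1, cubicSign, cubicSign, chi_mul,
      chi_eq_one_of_mem_gf hm hmn hy.2 hy.1, one_mul, mul_comm ω,
      ← relTr_mul_mul (mem_gf.1 hy.2), absTr_relTr hm.pos hm']
  rw [sum_congr rfl h2, ← mul_sum, sum_erase_sgn_absTr_mul hF hm' hm.pos
    (relTr_mem_gf hm' (by rw [gf_eq_univ hF]; exact mem_univ _))]
  split_ifs <;> ring

/-- Among the `x` with `Tr^n_{2m}(xω) ≠ 0`, those with `Tr^n_m(xω) = 0` carry the fraction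
`1/(2^m+1)` of every sum of `(-1)^{f_a}`. -/
lemma sum_relTr_ne_zero_eq_zero [CharP F 2] {n k m : ℕ} (hF : Fintype.card F = 2 ^ n)
    (hm : 0 < m) (hmn : 2 * m ∣ n) (hmk : 2 * m ∣ k) (a ω : F) :
    (2 ^ m + 1) * ∑ x ∈ univ.erase (0 : F),
        (if relTr n (2 * m) (x * ω) ≠ 0 ∧ relTr n m (x * ω) = 0 then
          sgn (fA n k a x) else 0) =
      ∑ x ∈ univ.erase (0 : F),
        (if relTr n (2 * m) (x * ω) = 0 then 0 else sgn (fA n k a x)) := by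
  have hm2 : m ∣ 2 * m := dvd_mul_left m 2
  have h0 : (2 : ℤ) ^ m - 1 ≠ 0 := by
    have : (1 : ℤ) < 2 ^ m := one_lt_pow₀ one_lt_two hm.ne'
    omega
  apply mul_left_cancel₀ h0
  rw [← mul_assoc, show ((2 : ℤ) ^ m - 1) * (2 ^ m + 1) = 2 ^ (2 * m) - 1 by ring,
    sum_average hF hmn (by positivity), mul_sum]
  refine sum_congr rfl fun x _ => ?_
  set t := relTr n (2 * m) (x * ω) with ht
  have htm : t ∈ gf F (2 * m) := relTr_mem_gf hmn (by rw [gf_eq_univ hF]; exact mem_univ _)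
  have h2 : ∀ y ∈ (gf F (2 * m)).erase 0,
      (if relTr n (2 * m) (y * x * ω) ≠ 0 ∧ relTr n m (y * x * ω) = 0 then
        sgn (fA n k a (y * x)) else 0) =
      (if relTr (2 * m) m (y * t) = 0 then 1 else 0) *
        (if t = 0 then 0 else sgn (fA n k a x)) := by
    intro y hy
    rw [mem_erase] at hy
    rw [fA_mul_of_mem _ _ _ (mem_gf.1 (gf_subset hmk hy.2)) hy.1,
      ← relTr_trans hm (by positivity) hm2 hmn, relTr_mul_mul (mem_gf.1 hy.2), ← ht]
    by_cases h : t = 0 <;> simp [h, hy.1]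
  rw [sum_congr rfl h2, ← sum_mul]
  by_cases h : t = 0
  · simp [h]
  · rw [sum_relTr_eq_zero hF hmn (by positivity) hm2 htm h, two_mul, Nat.add_sub_cancel]

/-- The sum `S_ν` expanded over the whole multiplicative group. -/
lemma Snu_eq_sum [CharP F 2] {m μ : ℕ} (hF : Fintype.card F = 2 ^ (2 ^ (μ + 2) * m))
    (hm : Odd m) (hν : 0 < μ + 2) (a b ω : F) :
    (2 ^ m - 1) * Snu (2 ^ (μ + 2) * m) m (μ + 2) hν a b ω =
      ∑ x ∈ univ.erase (0 : F),
        if relTr (2 ^ (μ + 2) * m) (2 * m) (x * ω) ≠ 0 ∧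
            relTr (2 ^ (μ + 2) * m) m (x * ω) = 0 ∧ b * chi (2 ^ (μ + 2) * m) x = 1 then
          sgn (fA (2 ^ (μ + 2) * m) (2 ^ (μ + 1) * m) a x) else 0 := by
  have hmn : 2 * m ∣ 2 ^ (μ + 2) * m :=
    Nat.mul_dvd_mul_right (dvd_pow_self 2 (by omega)) m
  have hmk : m ∣ 2 ^ (μ + 1) * m := dvd_mul_left _ _
  rw [← gf_eq_univ hF, ← sum_polar_tuple hm.pos, Snu, ← filter_filter, sum_filter, mul_sum]
  refine sum_congr rfl fun c hc => ?_
  simp only [mem_filter, mem_univ, true_and] at hc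
  have hroot : ∀ i : Fin (μ + 2), c i ∈ unityRoots F (2 ^ (2 ^ (μ + 1 - (i : ℕ)) * m) + 1) :=
    fun i => mem_unityRoots.2 (hc i)
  have hchi : chi (2 ^ (μ + 2) * m) (∏ i, c i) =
      chi (2 ^ (μ + 2) * m) (c ⟨μ + 2 - 1, by omega⟩) := by
    rw [chi, ← prod_pow, prod_eq_single (⟨μ + 2 - 1, by omega⟩ : Fin (μ + 2)) ?_ (by simp)]
    · rfl
    intro i _ hi
    have hi' : (i : ℕ) < μ + 1 := by
      have h1 := i.isLt
      have h2 : (i : ℕ) ≠ μ + 1 := fun h => hi (Fin.ext h)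
      omega
    refine chi_eq_one_of_mem_unityRoots (k := 2 ^ (μ + 1 - (i : ℕ)) * m) ?_ ?_ (hroot i)
    · exact (even_two.pow_of_ne_zero (by omega)).mul_right m
    · rw [← mul_assoc, ← pow_succ']
      exact Nat.mul_dvd_mul_right (pow_dvd_pow 2 (by omega)) m
  have htail : (∏ i : Fin (μ + 1), c i.succ) ∈ gf F (2 ^ (μ + 1) * m) ∧
      (∏ i : Fin (μ + 1), c i.succ) ≠ 0 := by
    refine ⟨mem_gf.2 ?_, prod_ne_zero_iff.2 fun i _ => ne_zero_of_mem_unityRoots (hroot i.succ)⟩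
    rw [← prod_pow]
    refine prod_congr rfl fun i _ => ?_
    have h1 := pow_two_pow_two_mul (hroot i.succ)
    rw [← mul_assoc, ← pow_succ'] at h1
    refine mem_gf.1 (gf_subset ?_ (mem_gf.2 h1))
    refine Nat.mul_dvd_mul_right (pow_dvd_pow 2 ?_) m
    simp only [Fin.val_succ]
    omega
  rw [← card_gf_erase hF ((dvd_mul_left m 2).trans hmn) hm.pos, ← nsmul_eq_mul, ← sum_const]
  refine sum_congr rfl fun y hy => ?_
  rw [mem_erase] at hy
  have hfA : fA (2 ^ (μ + 2) * m) (2 ^ (μ + 1) * m) a ((∏ i, c i) * y) =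
      fA (2 ^ (μ + 2) * m) (2 ^ (μ + 2 - 1) * m) a (c ⟨0, hν⟩) := by
    rw [Fin.prod_univ_succ, mul_comm _ y, mul_comm (c 0), ← mul_assoc y]
    exact fA_mul_of_mem _ _ _ (mem_gf.1 (mul_mem_gf (gf_subset hmk hy.2) htail.1))
      (mul_ne_zero hy.1 htail.2) _
  rw [hfA, chi_mul, chi_eq_one_of_mem_gf hm hmn hy.2 hy.1, mul_one, hchi, mul_comm _ y,
    relTr_mul_mul (mem_gf.1 (gf_subset (dvd_mul_left m 2) hy.2)), relTr_mul_mul (mem_gf.1 hy.2)]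
  simp [hy.1]

end WalshTransform

/-- For `ν > 1`, `a ∈ F_{2^{m₁}}^*`, `b ∈ F_4^*` and `ω ∈ F_{2^n}^*` with `U_1`-polar
component `w₁`:
`3·(W_{f_{a,b}}(ω) − 1) = −(2·2^{(2^{ν−1}−1)·m} − 1)·(1 − K_{m₁}(a))
  − 2·2^{(2^{ν−1}−1)·m}·(2^{m−1} − 1)·(−1)^{f_a(w₁)} + 3·2^{m+1}·S_ν(a, b, ω)`. -/
theorem walsh_at_nonzero_even_case_full
    {F : Type*} [Field F] [Fintype F]
    (n ν m : ℕ) (hν : 1 < ν) (hm : Odd m) (hn : n = 2 ^ ν * m)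
    (hF : Fintype.card F = 2 ^ n)
    (a b : F) (ha : a ^ 2 ^ (2 ^ (ν - 1) * m) = a) (ha0 : a ≠ 0)
    (hb : b ^ 3 = 1) (hb0 : b ≠ 0)
    (ω w1 v : F) (hω : ω ≠ 0)
    (hw1 : w1 ^ (2 ^ (2 ^ (ν - 1) * m) + 1) = 1)
    (hv : v ^ 2 ^ (2 ^ (ν - 1) * m) = v) (hv0 : v ≠ 0)
    (hdec : ω = w1 * v) :
    3 * (walsh n (fAB n (2 ^ (ν - 1) * m) a b) ω - 1)
      = -((2 * 2 ^ ((2 ^ (ν - 1) - 1) * m) - 1) * (1 - kloo (2 ^ (ν - 1) * m) a))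
        - 2 * 2 ^ ((2 ^ (ν - 1) - 1) * m) * (2 ^ (m - 1) - 1)
            * sgn (fA n (2 ^ (ν - 1) * m) a w1)
        + 3 * 2 ^ (m + 1) * Snu n m ν (by omega) a b ω := by
  have := charP_two_of_card hF
  obtain ⟨μ, rfl⟩ : ∃ μ, ν = μ + 2 := ⟨ν - 2, by omega⟩
  subst hn
  subst hdec
  simp only [show μ + 2 - 1 = μ + 1 from rfl] at *
  set k := 2 ^ (μ + 1) * m with hk
  have hn2 : 2 ^ (μ + 2) * m = 2 * k := by rw [hk]; ring
  have hk0 : 0 < k := Nat.mul_pos (by positivity) hm.pos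
  have hmk : 2 * m ∣ k := Nat.mul_dvd_mul_right (dvd_pow_self 2 (by omega)) m
  have hw0 : w1 ≠ 0 := left_ne_zero_of_mul hω
  have hS := Snu_eq_sum hF hm (by omega) a b (w1 * v)
  rw [← hk, hn2] at hS
  rw [hn2] at hF ⊢
  have hmn : 2 * m ∣ 2 * k := hmk.trans (dvd_mul_left k 2)
  obtain ⟨g, hg, hg0, hchi⟩ := exists_mem_gf_chi_ne_one (j := 2 * m) (q := μ + 1) hF
    (even_two_mul m) (by rw [hk]; ring)
  have hgk : g ^ 2 ^ k = g := mem_gf.1 (gf_subset hmk hg)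
  have hW := walsh_sub_one hF hm hmn ((dvd_mul_left m 2).trans hmk) hk0 hb a (w1 * v)
  have hT0 := sum_mul_cubicSign hF (even_two_mul k) hb hg0 hchi
    (fun x => sgn (fA (2 * k) k a x)) fun x => by rw [fA_mul_of_mem _ _ _ hgk hg0]
  have hZ := sum_mul_cubicSign hF (even_two_mul k) hb hg0 hchi
    (fun x => if relTr (2 * k) (2 * m) (x * (w1 * v)) = 0 then sgn (fA (2 * k) k a x) else 0)
    fun x => by simp [relTr_mul_mul (mem_gf.1 hg), fA_mul_of_mem _ _ _ hgk hg0, hg0]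
  have hB := sum_relTr_ne_zero_eq_zero hF hm.pos hmn hmk a (w1 * v)
  have hA := sum_sgn_fA_relTr hF hk0 hmk (mem_gf.2 ha) ha0 hw0 (mem_gf.2 hv) hv0
  have hH := sum_sgn_fA hF hk0 (mem_gf.2 ha) ha0
  have hsplit : ∑ x ∈ univ.erase (0 : F), sgn (fA (2 * k) k a x) =
      ∑ x ∈ univ.erase (0 : F), (if relTr (2 * k) (2 * m) (x * (w1 * v)) = 0 then
        sgn (fA (2 * k) k a x) else 0) +
      ∑ x ∈ univ.erase (0 : F), (if relTr (2 * k) (2 * m) (x * (w1 * v)) = 0 then 0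
        else sgn (fA (2 * k) k a x)) := by
    rw [← sum_add_distrib]
    refine sum_congr rfl fun x _ => ?_
    split_ifs <;> simp
  have hT : ∑ x ∈ univ.erase (0 : F), (if relTr (2 * k) m (x * (w1 * v)) = 0 then
          sgn (fA (2 * k) k a x) else 0) * cubicSign (2 * k) b x =
      2 * (∑ x ∈ univ.erase (0 : F),
        if relTr (2 * k) (2 * m) (x * (w1 * v)) ≠ 0 ∧
            relTr (2 * k) m (x * (w1 * v)) = 0 ∧ b * chi (2 * k) x = 1 then
          sgn (fA (2 * k) k a x) else 0) -
      ∑ x ∈ univ.erase (0 : F),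
        (if relTr (2 * k) (2 * m) (x * (w1 * v)) ≠ 0 ∧ relTr (2 * k) m (x * (w1 * v)) = 0 then
          sgn (fA (2 * k) k a x) else 0) +
      ∑ x ∈ univ.erase (0 : F), (if relTr (2 * k) (2 * m) (x * (w1 * v)) = 0 then
        sgn (fA (2 * k) k a x) else 0) * cubicSign (2 * k) b x := by
    rw [mul_sum, ← sum_sub_distrib, ← sum_add_distrib]
    refine sum_congr rfl fun x _ => ?_
    have h0 : relTr (2 * k) (2 * m) (x * (w1 * v)) = 0 → relTr (2 * k) m (x * (w1 * v)) = 0 :=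
      fun h => by
        rw [← relTr_trans hm.pos (Nat.mul_pos two_pos hm.pos) (dvd_mul_left m 2) hmn, h,
          relTr_zero]
    by_cases h1 : relTr (2 * k) (2 * m) (x * (w1 * v)) = 0
    · simp [h1, h0 h1]
    · by_cases h2 : relTr (2 * k) m (x * (w1 * v)) = 0
      · by_cases h3 : b * chi (2 * k) x = 1
        · simp [h1, h2, h3, cubicSign]
          ring
        · simp [h1, h2, h3, cubicSign]
      · simp [h1, h2]
  rw [← hS] at hT
  rw [hT] at hW
  have hkm : 2 ^ ((2 ^ (μ + 1) - 1) * m) = (2 : ℤ) ^ (k - 2 * m) * 2 ^ m := by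
    rw [← pow_add, Nat.sub_mul, one_mul, ← hk]
    congr 1
    have := Nat.le_of_dvd hk0 hmk
    omega
  have hk2 : (2 : ℤ) ^ k = 2 ^ (k - 2 * m) * (2 ^ m) ^ 2 := by
    rw [← pow_mul, ← pow_add]
    congr 1
    have := Nat.le_of_dvd hk0 hmk
    omega
  have hm1 : (2 : ℤ) ^ m = 2 * 2 ^ (m - 1) := by
    rw [← pow_succ', Nat.sub_add_cancel hm.pos]
  have hne1 : (2 : ℤ) ^ m - 1 ≠ 0 := by
    have : (1 : ℤ) < 2 ^ m := one_lt_pow₀ one_lt_two hm.pos.ne'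
    omega
  have hne2 : (2 : ℤ) ^ m + 1 ≠ 0 := by positivity
  rw [hkm, pow_succ]
  rw [hk2] at hA hH
  rw [hH] at hsplit hT0
  rw [← hB, hA] at hsplit
  rw [hA] at hZ
  generalize walsh (2 * k) (fAB (2 * k) k a b) (w1 * v) = W at *
  generalize Snu (2 * k) m (μ + 2) _ a b (w1 * v) = S at *
  generalize kloo k a = K at *
  generalize sgn (fA (2 * k) k a w1) = s at *
  generalize (2 : ℤ) ^ (k - 2 * m) = R at *
  generalize ∑ x ∈ univ.erase (0 : F), (if relTr (2 * k) (2 * m) (x * (w1 * v)) = 0 then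
        sgn (fA (2 * k) k a x) else 0) * cubicSign (2 * k) b x = Z at *
  generalize ∑ x ∈ univ.erase (0 : F), sgn (fA (2 * k) k a x) * cubicSign (2 * k) b x = T at *
  generalize ∑ x ∈ univ.erase (0 : F),
        (if relTr (2 * k) (2 * m) (x * (w1 * v)) ≠ 0 ∧ relTr (2 * k) m (x * (w1 * v)) = 0 then
          sgn (fA (2 * k) k a x) else 0) = B at *
  generalize (2 : ℤ) ^ (m - 1) = P at *
  generalize (2 : ℤ) ^ m = Q at *
  subst hm1
  apply mul_left_cancel₀ hne1
  apply mul_left_cancel₀ hne2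
  linear_combination 3 * (2 * P + 1) * hW + (2 * P) * (2 * P + 1) * hZ - (2 * P + 1) * hT0 +
    3 * (2 * P) * hsplit
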